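/- arXiv:1202.3579 — 2 statements merged into one kernel-verified Lean document; each statement's English description precedes it below -/
import Mathlib

section
/- Let b, c, K, s₁, s₂, s₃ be complex constants with c ≠ 0. If u and v are two meromorphic solutions of (E), both having a pole at the same point z₀ ∈ ℂ, and their leading Laurent coefficients agree, i.e. lim_{z→z₀} (z−z₀)² u(z) = lim_{z→z₀} (z−z₀)² v(z), then u = v identically on ℂ. Consequently, for each point z₀ there exist at most two meromorphic solutions of (E) with a pole at z₀. -/
open Complex Filter Topology

noncomputable section

/-- `u` has a pole at `z₀`: `‖u z‖ → ∞` as `z → z₀`, `z ≠ z₀`. -/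
def IsPoleAt (u : ℂ → ℂ) (z₀ : ℂ) : Prop :=
  Tendsto (fun z => ‖u z‖) (𝓝[≠] z₀) atTop

/-- `u` is meromorphic on all of `ℂ`: at every point it is either analytic or has a pole. -/
def MeromorphicOnPlane (u : ℂ → ℂ) : Prop :=
  ∀ z : ℂ, AnalyticAt ℂ u z ∨ IsPoleAt u z

/-- Equation (E) at the point `z`. -/
def SatisfiesE (b c K s₁ s₂ s₃ : ℂ) (u : ℂ → ℂ) (z : ℂ) : Prop :=
  deriv u z * iteratedDeriv 3 u z - (1/2) * (iteratedDeriv 2 u z)^2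
    + 30 * b * (deriv u z)^2
    - (30 / c^2) * ((u z)^4 - 4*s₁*(u z)^3 + 6*s₂*(u z)^2 - 4*s₃*(u z)
        + 3*s₁^4 - 6*s₁^2*s₂ + 4*s₁*s₃) = K

/-- A meromorphic solution of (E). -/
def IsMeromorphicSolution (b c K s₁ s₂ s₃ : ℂ) (u : ℂ → ℂ) : Prop :=
  MeromorphicOnPlane u ∧ ∀ z : ℂ, AnalyticAt ℂ u z → SatisfiesE b c K s₁ s₂ s₃ u z

/-- Two meromorphic functions coincide identically (same poles, same values off poles). -/
def SameMeromorphicFn (u v : ℂ → ℂ) : Prop :=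
  (∀ z : ℂ, IsPoleAt u z ↔ IsPoleAt v z) ∧ ∀ z : ℂ, ¬ IsPoleAt u z → u z = v z

theorem AnalyticAt.not_isPoleAt {u : ℂ → ℂ} {z : ℂ} (h : AnalyticAt ℂ u z) : ¬ IsPoleAt u z :=
  not_tendsto_atTop_of_tendsto_nhds
    (h.continuousAt.norm.tendsto.mono_left nhdsWithin_le_nhds)

theorem IsPoleAt.congr {u v : ℂ → ℂ} {z : ℂ} (h : IsPoleAt u z) (huv : u =ᶠ[𝓝[≠] z] v) :
    IsPoleAt v z :=
  Tendsto.congr' (huv.fun_comp norm) h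

/-- The points where `‖u‖ → ∞` form a countable set, for an arbitrary function `u`. -/
theorem countable_setOf_isPoleAt (u : ℂ → ℂ) : {z | IsPoleAt u z}.Countable := by
  have key : ∀ n : ℕ, ({z | IsPoleAt u z} ∩ {z | ‖u z‖ ≤ n}).Countable := by
    intro n
    refine (HereditarilyLindelofSpace.isLindelof _).countable ?_
    rw [discreteTopology_subtype_iff]
    rintro z ⟨hz, -⟩
    rw [← disjoint_iff, disjoint_principal_right]
    filter_upwards [hz.eventually_gt_atTop (n : ℝ)] with w hw
    exact fun h => absurd h.2 (not_le.2 hw)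
  refine (Set.countable_iUnion key).mono fun z hz => ?_
  obtain ⟨n, hn⟩ := exists_nat_ge ‖u z‖
  exact Set.mem_iUnion.2 ⟨n, hz, hn⟩

theorem MeromorphicOnPlane.meromorphicAt {u : ℂ → ℂ} (hu : MeromorphicOnPlane u) (z₀ : ℂ) :
    MeromorphicAt u z₀ := by
  classical
  refine (hu z₀).elim AnalyticAt.meromorphicAt fun hp => ?_
  set g : ℂ → ℂ := fun z => if IsPoleAt u z then 0 else (u z)⁻¹ with hg
  have hg_pole : ∀ z, IsPoleAt u z → ContinuousAt g z := by
    intro z hz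
    have hgz : g z = 0 := if_pos hz
    rw [continuousAt_iff_punctured_nhds, hgz]
    refine squeeze_zero_norm (fun w => ?_) (tendsto_inv_atTop_zero.comp hz)
    by_cases hw : IsPoleAt u w <;> simp [hg, hw]
  have hg_an : ∀ z, ¬ IsPoleAt u z → u z ≠ 0 → AnalyticAt ℂ g z := by
    intro z hz h0
    have ha := (hu z).resolve_right hz
    refine (ha.inv h0).congr ?_
    filter_upwards [ha.eventually_analyticAt] with w hw
    simp [hg, hw.not_isPoleAt]
  obtain ⟨R, hR, hball⟩ := (nhdsWithin_hasBasis Metric.nhds_basis_closedBall _).mem_iff.1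
    (hp.eventually_gt_atTop 0)
  have hne : ∀ z ∈ Metric.closedBall z₀ R, ¬ IsPoleAt u z → u z ≠ 0 := by
    intro z hz hzp
    have : z ≠ z₀ := by rintro rfl; exact hzp hp
    exact norm_pos_iff.1 (hball ⟨hz, this⟩)
  lift R to NNReal using hR.le
  have hga : AnalyticAt ℂ g z₀ := by
    refine (Complex.hasFPowerSeriesOnBall_of_differentiable_off_countable
      (countable_setOf_isPoleAt u) (fun z hz => ?_) (fun z hz => ?_)
      (by exact_mod_cast hR)).analyticAt
    · by_cases h : IsPoleAt u z
      · exact (hg_pole z h).continuousWithinAt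
      · exact (hg_an z h (hne z hz h)).continuousAt.continuousWithinAt
    · exact (hg_an z hz.2 (hne z (Metric.ball_subset_closedBall hz.1) hz.2)).differentiableAt
  rcases hga.eventually_eq_zero_or_eventually_ne_zero with h | h
  · exfalso
    obtain ⟨z, hzp, hz0, hzb⟩ := ((countable_setOf_isPoleAt u).dense_compl ℂ).inter_nhds_nonempty
      (h.and (Metric.closedBall_mem_nhds z₀ hR))
    simp only [hg, if_neg (show ¬ IsPoleAt u z from hzp), inv_eq_zero] at hz0
    exact hne z hzb hzp hz0
  · refine hga.meromorphicAt.inv.congr ?_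
    filter_upwards [h] with z hz
    by_cases hzp : IsPoleAt u z
    · simp [hg, hzp] at hz
    · simp [hg, hzp]

/-- Laurent expansion of the derivative of `(z - z₀) ^ m * f z`. -/
theorem exists_deriv_eq_zpow_mul {u f : ℂ → ℂ} {z₀ : ℂ} {m : ℤ} (hf : AnalyticAt ℂ f z₀)
    (hu : ∀ᶠ z in 𝓝[≠] z₀, u z = (z - z₀) ^ m * f z) :
    ∃ g : ℂ → ℂ, AnalyticAt ℂ g z₀ ∧ g z₀ = m * f z₀ ∧
      ∀ᶠ z in 𝓝[≠] z₀, deriv u z = (z - z₀) ^ (m - 1) * g z := by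
  refine ⟨fun z => m * f z + (z - z₀) * deriv f z, ?_, by simp, ?_⟩
  · have := hf.deriv
    fun_prop
  · filter_upwards [eventually_eventually_nhdsWithin.2 hu, self_mem_nhdsWithin,
      nhdsWithin_le_nhds hf.eventually_analyticAt] with z hz hne hfz
    have hz0 : z - z₀ ≠ 0 := sub_ne_zero.2 hne
    have hev : u =ᶠ[𝓝 z] fun z => (z - z₀) ^ m * f z := by
      rwa [isOpen_compl_singleton.nhdsWithin_eq hne] at hz
    have h1 : HasDerivAt (fun z : ℂ => (z - z₀) ^ m) (m * (z - z₀) ^ (m - 1)) z := by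
      simpa using (hasDerivAt_zpow m (z - z₀) (Or.inl hz0)).comp_sub_const z z₀
    rw [hev.deriv_eq, (h1.fun_mul hfz.differentiableAt.hasDerivAt).deriv]
    have : (z - z₀) ^ m = (z - z₀) ^ (m - 1) * (z - z₀) := by
      rw [← zpow_add_one₀ hz0, sub_add_cancel]
    rw [this]; ring

/-- Laurent expansions of the first three derivatives of `(z - z₀) ^ m * f z`. -/
theorem exists_iteratedDeriv_eq_zpow_mul {u f : ℂ → ℂ} {z₀ : ℂ} {m : ℤ} (hf : AnalyticAt ℂ f z₀)
    (hu : ∀ᶠ z in 𝓝[≠] z₀, u z = (z - z₀) ^ m * f z) :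
    ∃ f₁ f₂ f₃ : ℂ → ℂ, ContinuousAt f₁ z₀ ∧ ContinuousAt f₂ z₀ ∧ ContinuousAt f₃ z₀ ∧
      f₁ z₀ = m * f z₀ ∧ f₂ z₀ = (m - 1) * (m * f z₀) ∧
      f₃ z₀ = (m - 2) * ((m - 1) * (m * f z₀)) ∧
      ∀ᶠ z in 𝓝[≠] z₀, deriv u z = (z - z₀) ^ (m - 1) * f₁ z ∧
        iteratedDeriv 2 u z = (z - z₀) ^ (m - 2) * f₂ z ∧
        iteratedDeriv 3 u z = (z - z₀) ^ (m - 3) * f₃ z := by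
  obtain ⟨f₁, hf₁, hf₁0, h₁⟩ := exists_deriv_eq_zpow_mul hf hu
  obtain ⟨f₂, hf₂, hf₂0, h₂⟩ := exists_deriv_eq_zpow_mul hf₁ h₁
  obtain ⟨f₃, hf₃, hf₃0, h₃⟩ := exists_deriv_eq_zpow_mul hf₂ h₂
  refine ⟨f₁, f₂, f₃, hf₁.continuousAt, hf₂.continuousAt, hf₃.continuousAt, hf₁0, ?_, ?_, ?_⟩
  · rw [hf₂0, hf₁0]; push_cast; ring
  · rw [hf₃0, hf₂0, hf₁0]; push_cast; ring
  · filter_upwards [h₁, h₂, h₃] with z e₁ e₂ e₃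
    refine ⟨e₁, ?_, ?_⟩
    · rw [iteratedDeriv_succ, iteratedDeriv_one, e₂]; congr 2; ring
    · rw [iteratedDeriv_succ, iteratedDeriv_succ, iteratedDeriv_one, e₃]; congr 2; ring

theorem ContinuousAt.eq_zero_of_eventually_punctured {F : ℂ → ℂ} {z₀ : ℂ}
    (hF : ContinuousAt F z₀) (h : ∀ᶠ z in 𝓝[≠] z₀, F z = 0) : F z₀ = 0 :=
  tendsto_nhds_unique (hF.tendsto.mono_left nhdsWithin_le_nhds)
    (tendsto_const_nhds.congr' (h.mono fun _ hz => hz.symm))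

/-- The weighted difference of two instances of (E), with `w = u - v`, expressed through the
rescaled jets of `u` (`fᵢ = x ^ (i + 2) * uᵢ`) and `w` (`q * hᵢ = x ^ i * wᵢ`). -/
theorem weighted_difference_eq_zero {A b K s₁ s₂ s₃ x q S u₀ u₁ u₂ u₃ v₀ v₁ v₂ v₃
    f₀ f₁ f₂ f₃ h₀ h₁ h₂ h₃ : ℂ}
    (hu : u₁ * u₃ - (1/2) * u₂ ^ 2 + 30 * b * u₁ ^ 2
      - A * (u₀ ^ 4 - 4 * s₁ * u₀ ^ 3 + 6 * s₂ * u₀ ^ 2 - 4 * s₃ * u₀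
        + 3 * s₁ ^ 4 - 6 * s₁ ^ 2 * s₂ + 4 * s₁ * s₃) = K)
    (hv : v₁ * v₃ - (1/2) * v₂ ^ 2 + 30 * b * v₁ ^ 2
      - A * (v₀ ^ 4 - 4 * s₁ * v₀ ^ 3 + 6 * s₂ * v₀ ^ 2 - 4 * s₃ * v₀
        + 3 * s₁ ^ 4 - 6 * s₁ ^ 2 * s₂ + 4 * s₁ * s₃) = K)
    (hq : q ≠ 0) (hS : S = x ^ 2 * q)
    (hf₀ : x ^ 2 * u₀ = f₀) (hf₁ : x ^ 3 * u₁ = f₁) (hf₂ : x ^ 4 * u₂ = f₂) (hf₃ : x ^ 5 * u₃ = f₃)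
    (hh₀ : u₀ - v₀ = q * h₀) (hh₁ : x * (u₁ - v₁) = q * h₁)
    (hh₂ : x ^ 2 * (u₂ - v₂) = q * h₂) (hh₃ : x ^ 3 * (u₃ - v₃) = q * h₃) :
    f₁ * h₃ + h₁ * f₃ - S * (h₁ * h₃) - f₂ * h₂ + (1/2) * S * h₂ ^ 2
      + 30 * b * x ^ 2 * (2 * f₁ * h₁ - S * h₁ ^ 2)
      - A * (4 * f₀ ^ 3 * h₀ - 6 * f₀ ^ 2 * S * h₀ ^ 2 + 4 * f₀ * S ^ 2 * h₀ ^ 3 - S ^ 3 * h₀ ^ 4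
        - 4 * s₁ * x ^ 2 * (3 * f₀ ^ 2 * h₀ - 3 * f₀ * S * h₀ ^ 2 + S ^ 2 * h₀ ^ 3)
        + 6 * s₂ * x ^ 4 * (2 * f₀ * h₀ - S * h₀ ^ 2)
        - 4 * s₃ * x ^ 6 * h₀) = 0 := by
  refine (mul_eq_zero.1 ?_).resolve_left hq
  trans f₁ * (q * h₃) + (q * h₁) * f₃ - x ^ 2 * ((q * h₁) * (q * h₃)) - f₂ * (q * h₂)
      + (1/2) * x ^ 2 * (q * h₂) ^ 2
      + 30 * b * x ^ 2 * (2 * f₁ * (q * h₁) - x ^ 2 * (q * h₁) ^ 2)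
      - A * (4 * f₀ ^ 3 * (q * h₀) - 6 * f₀ ^ 2 * x ^ 2 * (q * h₀) ^ 2
        + 4 * f₀ * x ^ 4 * (q * h₀) ^ 3 - x ^ 6 * (q * h₀) ^ 4
        - 4 * s₁ * x ^ 2 * (3 * f₀ ^ 2 * (q * h₀) - 3 * f₀ * x ^ 2 * (q * h₀) ^ 2
          + x ^ 4 * (q * h₀) ^ 3)
        + 6 * s₂ * x ^ 4 * (2 * f₀ * (q * h₀) - x ^ 2 * (q * h₀) ^ 2)
        - 4 * s₃ * x ^ 6 * (q * h₀))
  · rw [hS]; ring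
  · rw [← hh₀, ← hh₁, ← hh₂, ← hh₃, ← hf₀, ← hf₁, ← hf₂, ← hf₃]
    linear_combination x ^ 6 * (hu - hv)

section Solutions

variable {b c K s₁ s₂ s₃ : ℂ} {u v : ℂ → ℂ} {z₀ : ℂ}

theorem IsMeromorphicSolution.eventually_satisfiesE (hu : IsMeromorphicSolution b c K s₁ s₂ s₃ u)
    (z₀ : ℂ) : ∀ᶠ z in 𝓝[≠] z₀, SatisfiesE b c K s₁ s₂ s₃ u z :=
  (hu.1.meromorphicAt z₀).eventually_analyticAt.mono hu.2

/-- Poles of solutions are double, with leading Laurent coefficient `±c`. -/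
theorem IsMeromorphicSolution.exists_laurent (hc : c ≠ 0)
    (hu : IsMeromorphicSolution b c K s₁ s₂ s₃ u) (hp : IsPoleAt u z₀) :
    ∃ f : ℂ → ℂ, AnalyticAt ℂ f z₀ ∧ f z₀ ^ 2 = c ^ 2 ∧
      ∀ᶠ z in 𝓝[≠] z₀, u z = (z - z₀) ^ (-2 : ℤ) * f z := by
  have hm := hu.1.meromorphicAt z₀
  have hneg : meromorphicOrderAt u z₀ < 0 :=
    (tendsto_cobounded_iff_meromorphicOrderAt_neg hm).1 (tendsto_norm_atTop_iff_cobounded.1 hp)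
  obtain ⟨m, hmeq⟩ := WithTop.ne_top_iff_exists.1 hneg.ne_top
  obtain ⟨f, hf, hf0, hfu⟩ := (meromorphicOrderAt_eq_int_iff hm).1 hmeq.symm
  simp only [smul_eq_mul] at hfu
  have hm0 : m < 0 := by rw [← hmeq] at hneg; exact_mod_cast hneg
  obtain ⟨f₁, f₂, f₃, hc₁, hc₂, hc₃, h₁0, h₂0, h₃0, hd⟩ := exists_iteratedDeriv_eq_zpow_mul hf hfu
  have hc₀ := hf.continuousAt
  obtain ⟨n, rfl⟩ : ∃ n : ℕ, m = -((n : ℤ) + 1) := ⟨(-m - 1).toNat, by omega⟩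
  have hev : ∀ᶠ z in 𝓝[≠] z₀, (z - z₀) ^ (n + 1) * u z = f z ∧
      (z - z₀) ^ (n + 2) * deriv u z = f₁ z ∧
      (z - z₀) ^ (n + 3) * iteratedDeriv 2 u z = f₂ z ∧
      (z - z₀) ^ (n + 4) * iteratedDeriv 3 u z = f₃ z := by
    filter_upwards [hfu, hd, self_mem_nhdsWithin] with z e₀ ⟨e₁, e₂, e₃⟩ hne
    have hz0 : z - z₀ ≠ 0 := sub_ne_zero.2 hne
    have hz : ∀ (k : ℕ) (j : ℤ), (k : ℤ) + j = 0 → ∀ a : ℂ,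
        (z - z₀) ^ k * ((z - z₀) ^ j * a) = a := by
      intro k j hkj a
      rw [← mul_assoc, ← zpow_natCast, ← zpow_add₀ hz0, hkj, zpow_zero, one_mul]
    rw [e₀, e₁, e₂, e₃]
    exact ⟨hz _ _ (by push_cast; ring) _, hz _ _ (by push_cast; ring) _,
      hz _ _ (by push_cast; ring) _, hz _ _ (by push_cast; ring) _⟩
  have hE := hu.eventually_satisfiesE z₀
  obtain rfl | rfl | ⟨k, rfl⟩ : n = 0 ∨ n = 1 ∨ ∃ k, n = k + 2 := by
    rcases n with _ | _ | k
    exacts [.inl rfl, .inr (.inl rfl), .inr (.inr ⟨k, rfl⟩)]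
  · exfalso
    have := ContinuousAt.eq_zero_of_eventually_punctured (z₀ := z₀) (F := fun z =>
      f₁ z * f₃ z - (1/2) * f₂ z ^ 2 + 30 * b * (z - z₀) ^ 2 * f₁ z ^ 2
        - (30 / c^2) * ((z - z₀) ^ 2 * f z ^ 4 - 4*s₁*(z - z₀) ^ 3 * f z ^ 3
          + 6*s₂*(z - z₀) ^ 4 * f z ^ 2 - 4*s₃*(z - z₀) ^ 5 * f z
          + (z - z₀) ^ 6 * (3*s₁^4 - 6*s₁^2*s₂ + 4*s₁*s₃)) - (z - z₀) ^ 6 * K)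
      (by fun_prop) (by
        filter_upwards [hE, hev] with z hz ⟨e₀, e₁, e₂, e₃⟩
        rw [← e₀, ← e₁, ← e₂, ← e₃]
        unfold SatisfiesE at hz
        linear_combination (z - z₀) ^ 6 * hz)
    simp only [sub_self, h₁0, h₂0, h₃0] at this
    push_cast at this
    refine pow_ne_zero 2 hf0 ?_
    linear_combination this / 4
  · have := ContinuousAt.eq_zero_of_eventually_punctured (z₀ := z₀) (F := fun z =>
      f₁ z * f₃ z - (1/2) * f₂ z ^ 2 + 30 * b * (z - z₀) ^ 2 * f₁ z ^ 2
        - (30 / c^2) * (f z ^ 4 - 4*s₁*(z - z₀) ^ 2 * f z ^ 3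
          + 6*s₂*(z - z₀) ^ 4 * f z ^ 2 - 4*s₃*(z - z₀) ^ 6 * f z
          + (z - z₀) ^ 8 * (3*s₁^4 - 6*s₁^2*s₂ + 4*s₁*s₃)) - (z - z₀) ^ 8 * K)
      (by fun_prop) (by
        filter_upwards [hE, hev] with z hz ⟨e₀, e₁, e₂, e₃⟩
        rw [← e₀, ← e₁, ← e₂, ← e₃]
        unfold SatisfiesE at hz
        linear_combination (z - z₀) ^ 8 * hz)
    simp only [sub_self, h₁0, h₂0, h₃0] at this
    push_cast at this
    refine ⟨f, hf, ?_, by simpa using hfu⟩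
    refine mul_left_cancel₀ (pow_ne_zero 2 hf0) ?_
    field_simp at this
    linear_combination -this / 30
  · exfalso
    have := ContinuousAt.eq_zero_of_eventually_punctured (z₀ := z₀) (F := fun z =>
      (z - z₀) ^ (2 * k + 2) * (f₁ z * f₃ z - (1/2) * f₂ z ^ 2)
        + 30 * b * (z - z₀) ^ (2 * k + 4) * f₁ z ^ 2
        - (30 / c^2) * (f z ^ 4 - 4*s₁*(z - z₀) ^ (k + 3) * f z ^ 3
          + 6*s₂*(z - z₀) ^ (2 * k + 6) * f z ^ 2 - 4*s₃*(z - z₀) ^ (3 * k + 9) * f z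
          + (z - z₀) ^ (4 * k + 12) * (3*s₁^4 - 6*s₁^2*s₂ + 4*s₁*s₃))
        - (z - z₀) ^ (4 * k + 12) * K)
      (by fun_prop) (by
        filter_upwards [hE, hev] with z hz ⟨e₀, e₁, e₂, e₃⟩
        rw [← e₀, ← e₁, ← e₂, ← e₃]
        unfold SatisfiesE at hz
        linear_combination (z - z₀) ^ (4 * k + 12) * hz)
    simp [hc, hf0] at this

/-- The leading Laurent coefficient at a pole determines the germ of a solution there: the
indicial polynomial `(r + 3) * (r ^ 2 - 3 * r + 20)` has no integer root `r ≥ -1`. -/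
theorem IsMeromorphicSolution.eventuallyEq_of_laurent (hc : c ≠ 0)
    (hu : IsMeromorphicSolution b c K s₁ s₂ s₃ u) (hv : IsMeromorphicSolution b c K s₁ s₂ s₃ v)
    {f g : ℂ → ℂ} (hf : AnalyticAt ℂ f z₀) (hg : AnalyticAt ℂ g z₀)
    (hfc : f z₀ ^ 2 = c ^ 2) (hfg : f z₀ = g z₀)
    (hfu : ∀ᶠ z in 𝓝[≠] z₀, u z = (z - z₀) ^ (-2 : ℤ) * f z)
    (hgv : ∀ᶠ z in 𝓝[≠] z₀, v z = (z - z₀) ^ (-2 : ℤ) * g z) :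
    u =ᶠ[𝓝[≠] z₀] v := by
  by_cases hzero : ∀ᶠ z in 𝓝 z₀, (f - g) z = 0
  · filter_upwards [nhdsWithin_le_nhds hzero, hfu, hgv] with z hz e₁ e₂
    rw [e₁, e₂, sub_eq_zero.1 hz]
  exfalso
  obtain ⟨n, h, hh, hh0, hn⟩ := (hf.sub hg).exists_eventuallyEq_pow_smul_nonzero_iff.2 hzero
  simp only [smul_eq_mul, Pi.sub_apply] at hn
  have hn0 : n ≠ 0 := by
    rintro rfl
    have := hn.self_of_nhds
    simp [hfg] at this
    exact hh0 this.symm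
  have hw : ∀ᶠ z in 𝓝[≠] z₀, (u - v) z = (z - z₀) ^ ((n : ℤ) - 2) * h z := by
    filter_upwards [hfu, hgv, nhdsWithin_le_nhds hn, self_mem_nhdsWithin] with z e₁ e₂ e hne
    have hz0 : z - z₀ ≠ 0 := sub_ne_zero.2 hne
    rw [Pi.sub_apply, e₁, e₂, ← mul_sub, e, ← mul_assoc, ← zpow_natCast, ← zpow_add₀ hz0]
    rfl
  obtain ⟨f₁, f₂, f₃, hf₁, hf₂, hf₃, hf₁0, hf₂0, hf₃0, hdf⟩ :=
    exists_iteratedDeriv_eq_zpow_mul hf hfu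
  obtain ⟨h₁, h₂, h₃, hh₁, hh₂, hh₃, hh₁0, hh₂0, hh₃0, hdh⟩ :=
    exists_iteratedDeriv_eq_zpow_mul hh hw
  have hf₀ := hf.continuousAt
  have hh₀ := hh.continuousAt
  have key := ContinuousAt.eq_zero_of_eventually_punctured (z₀ := z₀) (F := fun z =>
    f₁ z * h₃ z + h₁ z * f₃ z - (z - z₀) ^ n * (h₁ z * h₃ z) - f₂ z * h₂ z
      + (1/2) * (z - z₀) ^ n * h₂ z ^ 2
      + 30 * b * (z - z₀) ^ 2 * (2 * f₁ z * h₁ z - (z - z₀) ^ n * h₁ z ^ 2)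
      - (30 / c^2) * (4 * f z ^ 3 * h z - 6 * f z ^ 2 * (z - z₀) ^ n * h z ^ 2
        + 4 * f z * ((z - z₀) ^ n) ^ 2 * h z ^ 3 - ((z - z₀) ^ n) ^ 3 * h z ^ 4
        - 4 * s₁ * (z - z₀) ^ 2 * (3 * f z ^ 2 * h z - 3 * f z * (z - z₀) ^ n * h z ^ 2
          + ((z - z₀) ^ n) ^ 2 * h z ^ 3)
        + 6 * s₂ * (z - z₀) ^ 4 * (2 * f z * h z - (z - z₀) ^ n * h z ^ 2)
        - 4 * s₃ * (z - z₀) ^ 6 * h z))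
    (by fun_prop) (by
      filter_upwards [hu.eventually_satisfiesE z₀, hv.eventually_satisfiesE z₀, hfu, hw, hdf, hdh,
        (hu.1.meromorphicAt z₀).eventually_analyticAt,
        (hv.1.meromorphicAt z₀).eventually_analyticAt, self_mem_nhdsWithin]
        with z hEu hEv e₀ d₀ ⟨e₁, e₂, e₃⟩ ⟨d₁, d₂, d₃⟩ hau hav hne
      have hz0 : z - z₀ ≠ 0 := sub_ne_zero.2 hne
      unfold SatisfiesE at hEu hEv
      rw [show deriv (u - v) z = _ from deriv_sub hau.differentiableAt hav.differentiableAt] at d₁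
      rw [iteratedDeriv_sub hau.contDiffAt hav.contDiffAt] at d₂ d₃
      rw [Pi.sub_apply] at d₀
      have hz : ∀ (k : ℕ) (j l : ℤ), (k : ℤ) + j = l → ∀ a : ℂ,
          (z - z₀) ^ k * ((z - z₀) ^ j * a) = (z - z₀) ^ l * a := by
        intro k j l hkj a
        rw [← mul_assoc, ← zpow_natCast, ← zpow_add₀ hz0, hkj]
      have hz' : ∀ (k : ℕ) (j : ℤ), (k : ℤ) + j = 0 → ∀ a : ℂ,
          (z - z₀) ^ k * ((z - z₀) ^ j * a) = a := by
        intro k j hkj a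
        rw [hz k j 0 hkj, zpow_zero, one_mul]
      refine weighted_difference_eq_zero hEu hEv (zpow_ne_zero ((n : ℤ) - 2) hz0) ?_
        (by rw [e₀, hz' _ _ (by norm_num)]) (by rw [e₁, hz' _ _ (by norm_num)])
        (by rw [e₂, hz' _ _ (by norm_num)]) (by rw [e₃, hz' _ _ (by norm_num)]) d₀
        (by rw [d₁]; simpa only [pow_one] using hz 1 _ ((n : ℤ) - 2) (by push_cast; ring) _)
        (by rw [d₂]; exact hz 2 _ _ (by push_cast; ring) _)
        (by rw [d₃]; exact hz 3 _ _ (by push_cast; ring) _)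
      rw [← zpow_natCast, ← zpow_natCast, ← zpow_add₀ hz0]
      congr 1; push_cast; ring)
  simp only [sub_self, hf₁0, hf₂0, hf₃0, hh₁0, hh₂0, hh₃0, zero_pow hn0] at key
  push_cast at key
  have hf0 : f z₀ ≠ 0 := fun h0 => hc (by simpa [h0] using hfc.symm)
  have hind : ((n : ℂ) + 1) * ((n : ℂ) ^ 2 - 7 * n + 30) ≠ 0 := by
    have : ((n : ℤ) + 1) * ((n : ℤ) ^ 2 - 7 * n + 30) ≠ 0 :=
      mul_ne_zero (by positivity) (by nlinarith [sq_nonneg ((n : ℤ) - 3)])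
    exact_mod_cast this
  refine mul_ne_zero (mul_ne_zero hf0 hh0) hind ?_
  rw [← hfc] at key
  have hquartic : 30 / f z₀ ^ 2 * (4 * f z₀ ^ 3 * h z₀) = 120 * f z₀ * h z₀ := by
    field_simp; norm_num
  linear_combination -key / 2 - hquartic / 2

theorem IsMeromorphicSolution.sameMeromorphicFn (hu : IsMeromorphicSolution b c K s₁ s₂ s₃ u)
    (hv : IsMeromorphicSolution b c K s₁ s₂ s₃ v) (huv : u =ᶠ[𝓝[≠] z₀] v) :
    SameMeromorphicFn u v := by
  have hm : Meromorphic (u - v) := fun z => (hu.1.meromorphicAt z).sub (hv.1.meromorphicAt z)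
  have hall : ∀ z, u =ᶠ[𝓝[≠] z] v := by
    intro z
    have htop : meromorphicOrderAt (u - v) z = ⊤ := by
      by_contra hz
      refine hm.exists_meromorphicOrderAt_ne_top_iff_forall.1 ⟨z, hz⟩ z₀ ?_
      exact meromorphicOrderAt_eq_top_iff.2 (huv.mono fun w hw => sub_eq_zero.2 hw)
    exact (meromorphicOrderAt_eq_top_iff.1 htop).mono fun w hw => sub_eq_zero.1 hw
  have hiff : ∀ z, IsPoleAt u z ↔ IsPoleAt v z := fun z =>
    ⟨fun h => h.congr (hall z), fun h => h.congr (hall z).symm⟩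
  refine ⟨hiff, fun z hz => ?_⟩
  have hau := (hu.1 z).resolve_right hz
  have hav := (hv.1 z).resolve_right (mt (hiff z).2 hz)
  exact ((hau.continuousAt.eventuallyEq_nhds_iff_eventuallyEq_nhdsNE hav.continuousAt).1
    (hall z)).self_of_nhds

end Solutions

theorem tendsto_sq_mul_of_laurent {u f : ℂ → ℂ} {z₀ : ℂ} (hf : AnalyticAt ℂ f z₀)
    (hfu : ∀ᶠ z in 𝓝[≠] z₀, u z = (z - z₀) ^ (-2 : ℤ) * f z) :
    Tendsto (fun z => (z - z₀) ^ 2 * u z) (𝓝[≠] z₀) (𝓝 (f z₀)) := by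
  refine (hf.continuousAt.tendsto.mono_left nhdsWithin_le_nhds).congr' ?_
  filter_upwards [hfu, self_mem_nhdsWithin] with z hz hne
  have hz0 : z - z₀ ≠ 0 := sub_ne_zero.2 hne
  rw [hz, ← mul_assoc, ← zpow_natCast, ← zpow_add₀ hz0]
  simp

/-- Two meromorphic solutions of (E) with a pole at the same point `z₀` and equal leading
Laurent coefficients coincide identically on `ℂ`; consequently at most two meromorphic
solutions of (E) have a pole at any given point `z₀`. -/
theorem solution_determined_by_leading_coefficient
    (b c K s₁ s₂ s₃ : ℂ) (hc : c ≠ 0) (z₀ : ℂ)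
    (u v : ℂ → ℂ)
    (hu : IsMeromorphicSolution b c K s₁ s₂ s₃ u)
    (hv : IsMeromorphicSolution b c K s₁ s₂ s₃ v)
    (hup : IsPoleAt u z₀) (hvp : IsPoleAt v z₀)
    (α₀ : ℂ)
    (hlu : Tendsto (fun z => (z - z₀)^2 * u z) (𝓝[≠] z₀) (𝓝 α₀))
    (hlv : Tendsto (fun z => (z - z₀)^2 * v z) (𝓝[≠] z₀) (𝓝 α₀)) :
    SameMeromorphicFn u v ∧
      ∀ w : Fin 3 → ℂ → ℂ,
        (∀ i, IsMeromorphicSolution b c K s₁ s₂ s₃ (w i) ∧ IsPoleAt (w i) z₀) →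
        ∃ i j : Fin 3, i ≠ j ∧ SameMeromorphicFn (w i) (w j) := by
  refine ⟨?_, fun w hw => ?_⟩
  · obtain ⟨f, hf, hfc, hfu⟩ := hu.exists_laurent hc hup
    obtain ⟨g, hg, -, hgv⟩ := hv.exists_laurent hc hvp
    have hfα := tendsto_nhds_unique (tendsto_sq_mul_of_laurent hf hfu) hlu
    have hgα := tendsto_nhds_unique (tendsto_sq_mul_of_laurent hg hgv) hlv
    exact hu.sameMeromorphicFn hv
      (hu.eventuallyEq_of_laurent hc hv hf hg hfc (hfα.trans hgα.symm) hfu hgv)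
  · choose f hf hfc hfw using fun i => (hw i).1.exists_laurent hc (hw i).2
    obtain ⟨i, j, hij, hfij⟩ : ∃ i j : Fin 3, i ≠ j ∧ f i z₀ = f j z₀ := by
      have hpm : ∀ i, f i z₀ = c ∨ f i z₀ = -c := fun i => sq_eq_sq_iff_eq_or_eq_neg.1 (hfc i)
      obtain ⟨i, j, hij, h⟩ := Fintype.exists_ne_map_eq_of_card_lt
        (fun i => decide (f i z₀ = c)) (by simp)
      refine ⟨i, j, hij, ?_⟩
      rcases hpm i with hi | hi <;> rcases hpm j with hj | hj <;> simp_all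
    exact ⟨i, j, hij, (hw i).1.sameMeromorphicFn (hw j).1 ((hw i).1.eventuallyEq_of_laurent hc
      (hw j).1 (hf i) (hf j) (hfc i) hfij (hfw i) (hfw j))⟩

end
end

section
/- Let b, c, K, s₁, s₂, s₃ be complex constants with c ≠ 0, and let u be a meromorphic solution of (E). If u is not a rational function (i.e. u is transcendental), then u has infinitely many poles in ℂ. -/
open Complex Filter Topology

noncomputable section

/-- `u` is a rational function of `z`. -/
def IsRationalFunction (u : ℂ → ℂ) : Prop :=
  ∃ p q : Polynomial ℂ, q ≠ 0 ∧
    ∀ z : ℂ, AnalyticAt ℂ u z → Polynomial.eval z q ≠ 0 →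
      u z = Polynomial.eval z p / Polynomial.eval z q

/-- A polynomial grows at infinity at most like `z ^ natDegree`. -/
lemma Polynomial.isBigO_eval_cobounded_pow_natDegree (q : Polynomial ℂ) :
    (fun z : ℂ => q.eval z) =O[Bornology.cobounded ℂ] fun z => z ^ q.natDegree := by
  simp_rw [Polynomial.eval_eq_sum_range]
  refine Asymptotics.IsBigO.fun_sum fun i hi => Asymptotics.IsBigO.const_mul_left ?_ _
  refine Asymptotics.IsBigO.of_bound 1 ?_
  filter_upwards [(tendsto_norm_cobounded_atTop (E := ℂ)).eventually_ge_atTop 1] with z hz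
  rw [norm_pow, norm_pow, one_mul]
  exact pow_le_pow_right₀ hz (Nat.lt_succ_iff.mp (Finset.mem_range.mp hi))

/-- **Generalized Liouville theorem**: an entire function of polynomial growth is a polynomial. -/
lemma Differentiable.exists_polynomial_of_isBigO {g : ℂ → ℂ} (hg : Differentiable ℂ g) {N : ℕ}
    (hO : g =O[Bornology.cobounded ℂ] fun z => z ^ N) :
    ∃ p : Polynomial ℂ, ∀ z, g z = p.eval z := by
  obtain ⟨C, hC⟩ := hO.bound
  rw [← comap_norm_atTop, eventually_comap] at hC
  have hzero : ∀ n, N < n → iteratedDeriv n g 0 = 0 := by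
    intro n hn
    have hlim : Tendsto (fun R : ℝ => n.factorial * C * (R ^ (n - N))⁻¹) atTop (𝓝 0) := by
      simpa using ((tendsto_pow_atTop (α := ℝ) (Nat.sub_ne_zero_of_lt hn)).inv_tendsto_atTop).const_mul
          ((n.factorial : ℝ) * C)
    refine norm_le_zero_iff.mp (ge_of_tendsto hlim ?_)
    filter_upwards [hC, eventually_gt_atTop 0] with R hR hR0
    refine (norm_iteratedDeriv_le_of_forall_mem_sphere_norm_le n hR0 hg.diffContOnCl
      (C := C * R ^ N) fun z hz => ?_).trans_eq ?_
    · have hz' : ‖z‖ = R := by simpa using hz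
      simpa [hz'] using hR z hz'
    · rw [← Nat.sub_add_cancel hn.le, pow_add]
      simp only [Nat.sub_add_cancel hn.le]
      field_simp
  refine ⟨∑ n ∈ Finset.range (N + 1),
    Polynomial.monomial n ((n.factorial : ℂ)⁻¹ * iteratedDeriv n g 0), fun z => ?_⟩
  rw [← taylorSeries_eq_of_entire' 0 z hg, tsum_eq_sum (s := Finset.range (N + 1))]
  · simp [Polynomial.eval_finsetSum]
  · intro n hn
    rw [hzero n (by simpa using hn)]
    simp

/-- A function that is analytic on a punctured neighbourhood of a point and tends to infinity
there is meromorphic at that point. -/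
lemma IsPoleAt.meromorphicAt {u : ℂ → ℂ} {z₀ : ℂ} (h : IsPoleAt u z₀)
    (ha : ∀ᶠ z in 𝓝[≠] z₀, AnalyticAt ℂ u z) : MeromorphicAt u z₀ := by
  have hlim : Tendsto u⁻¹ (𝓝[≠] z₀) (𝓝 0) := by
    rw [tendsto_zero_iff_norm_tendsto_zero]
    simpa only [Pi.inv_apply, norm_inv, Function.comp_def] using tendsto_inv_atTop_zero.comp h
  have hne : ∀ᶠ z in 𝓝[≠] z₀, u z ≠ 0 := by
    filter_upwards [h.eventually_gt_atTop 0] with z hz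
    exact norm_pos_iff.mp hz
  have heq : Function.update u⁻¹ z₀ 0 =ᶠ[𝓝[≠] z₀] u⁻¹ :=
    Function.update_eventuallyEq_nhdsNE u⁻¹ z₀ z₀ 0
  have han : AnalyticAt ℂ (Function.update u⁻¹ z₀ 0) z₀ := by
    refine analyticAt_of_differentiable_on_punctured_nhds_of_continuousAt ?_ ?_
    · filter_upwards [ha, hne, self_mem_nhdsWithin] with z hz hz0 hzz
      refine (hz.inv hz0).differentiableAt.congr_of_eventuallyEq ?_
      filter_upwards [isOpen_ne.mem_nhds hzz] with w hw
      exact Function.update_of_ne hw _ _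
    · exact continuousAt_update_same.mpr hlim
  simpa using (han.meromorphicAt.congr heq).inv

/-- The dominant-term estimate: at a point where (E) holds and where the derivatives of `u` obey
Cauchy-type bounds on the natural scale, `‖u z‖` is controlled by the scaling parameter `M`. -/
lemma SatisfiesE.norm_mul_le {b c K s₁ s₂ s₃ : ℂ} {u : ℂ → ℂ} {z : ℂ}
    (h : SatisfiesE b c K s₁ s₂ s₃ u z) {r M : ℝ} (hr : 0 < r) (hM : 1 ≤ M)
    (hMU : M ≤ ‖u z‖) (hrM : 4 * r ^ 2 * ‖u z‖ = M)
    (h1 : ‖deriv u z‖ ≤ 4 * ‖u z‖ / r)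
    (h2 : ‖iteratedDeriv 2 u z‖ ≤ 8 * ‖u z‖ / r ^ 2)
    (h3 : ‖iteratedDeriv 3 u z‖ ≤ 24 * ‖u z‖ / r ^ 3) :
    ‖30 / c ^ 2‖ * M ≤ 2048 + 1920 * ‖b‖ + ‖K‖ + ‖30 / c ^ 2‖ *
      (4 * ‖s₁‖ + 6 * ‖s₂‖ + 4 * ‖s₃‖ + ‖3 * s₁ ^ 4 - 6 * s₁ ^ 2 * s₂ + 4 * s₁ * s₃‖) := by
  set U := ‖u z‖ with hU
  set A := 30 / c ^ 2
  set D := 3 * s₁ ^ 4 - 6 * s₁ ^ 2 * s₂ + 4 * s₁ * s₃ with hD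
  have hM0 : 0 < M := by linarith
  have hU1 : 1 ≤ U := hM.trans hMU
  have hU0 : 0 < U := by linarith
  have hEq : A * u z ^ 4 = deriv u z * iteratedDeriv 3 u z - (1/2) * (iteratedDeriv 2 u z)^2
      + 30 * b * (deriv u z)^2
      + A * (4*s₁*(u z)^3 - 6*s₂*(u z)^2 + 4*s₃*(u z) - D) - K := by
    unfold SatisfiesE at h
    rw [hD]
    linear_combination -h
  have hnorm : ‖A‖ * U ^ 4 ≤ ‖deriv u z‖ * ‖iteratedDeriv 3 u z‖
      + 1/2 * ‖iteratedDeriv 2 u z‖^2 + 30 * ‖b‖ * ‖deriv u z‖^2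
      + ‖A‖ * (4*‖s₁‖*U^3 + 6*‖s₂‖*U^2 + 4*‖s₃‖*U + ‖D‖) + ‖K‖ := by
    have hlow : ‖4*s₁*(u z)^3 - 6*s₂*(u z)^2 + 4*s₃*(u z) - D‖
        ≤ 4*‖s₁‖*U^3 + 6*‖s₂‖*U^2 + 4*‖s₃‖*U + ‖D‖ := by
      refine (norm_sub_le _ _).trans (add_le_add_left ((norm_add_le _ _).trans
        (add_le_add ((norm_sub_le _ _).trans_eq ?_) ?_)) _) <;> simp [hU]
    calc ‖A‖ * U ^ 4 = ‖A * u z ^ 4‖ := by simp [hU]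
      _ ≤ ‖deriv u z * iteratedDeriv 3 u z‖ + ‖(1/2) * (iteratedDeriv 2 u z)^2‖
          + ‖30 * b * (deriv u z)^2‖
          + ‖A * (4*s₁*(u z)^3 - 6*s₂*(u z)^2 + 4*s₃*(u z) - D)‖ + ‖K‖ := by
        rw [hEq]
        refine (norm_sub_le _ _).trans (add_le_add_left ((norm_add_le _ _).trans
          (add_le_add_left ((norm_add_le _ _).trans (add_le_add_left (norm_sub_le _ _) _)) _)) _)
      _ ≤ _ := by
        simp only [norm_mul, norm_pow, norm_div, norm_one, Complex.norm_ofNat]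
        gcongr
  have hr2 : 1 / r ^ 2 = 4 * U / M := by rw [← hrM]; field_simp
  have hr4 : U ^ 2 / r ^ 4 = 16 * U ^ 4 / M ^ 2 := by rw [← hrM]; field_simp; norm_num
  have hMM : U ^ 4 / M ^ 2 ≤ U ^ 4 / M := by
    gcongr
    nlinarith
  have h3M : U ^ 3 ≤ U ^ 4 / M := by
    rw [le_div_iff₀ hM0, pow_succ U 3]
    gcongr
  have e1 : ‖deriv u z‖ * ‖iteratedDeriv 3 u z‖ ≤ 1536 * (U ^ 4 / M) := by
    calc _ ≤ (4 * U / r) * (24 * U / r ^ 3) := by gcongr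
      _ = 96 * (U ^ 2 / r ^ 4) := by field_simp; norm_num
      _ = 1536 * (U ^ 4 / M ^ 2) := by rw [hr4]; ring
      _ ≤ _ := by gcongr
  have e2 : 1/2 * ‖iteratedDeriv 2 u z‖^2 ≤ 512 * (U ^ 4 / M) := by
    calc _ ≤ 1/2 * (8 * U / r ^ 2) ^ 2 := by gcongr
      _ = 32 * (U ^ 2 / r ^ 4) := by field_simp; norm_num
      _ = 512 * (U ^ 4 / M ^ 2) := by rw [hr4]; ring
      _ ≤ _ := by gcongr
  have e3 : 30 * ‖b‖ * ‖deriv u z‖^2 ≤ 1920 * ‖b‖ * (U ^ 4 / M) := by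
    calc _ ≤ 30 * ‖b‖ * (4 * U / r) ^ 2 := by gcongr
      _ = 480 * ‖b‖ * U ^ 2 * (1 / r ^ 2) := by ring
      _ = 1920 * ‖b‖ * (U ^ 3 / M) := by rw [hr2]; ring
      _ ≤ _ := by
        gcongr
        norm_num
  have e4 : 4*‖s₁‖*U^3 + 6*‖s₂‖*U^2 + 4*‖s₃‖*U + ‖D‖
      ≤ (4*‖s₁‖ + 6*‖s₂‖ + 4*‖s₃‖ + ‖D‖) * (U ^ 4 / M) := by
    have p2 : U ^ 2 ≤ U ^ 4 / M := (pow_le_pow_right₀ hU1 (by norm_num)).trans h3M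
    have p1 : U ≤ U ^ 4 / M := (le_self_pow₀ hU1 (by norm_num)).trans h3M
    have p0 : 1 ≤ U ^ 4 / M := hU1.trans p1
    have pD : ‖D‖ ≤ ‖D‖ * (U ^ 4 / M) := le_mul_of_one_le_right (norm_nonneg _) p0
    calc _ ≤ 4*‖s₁‖*(U ^ 4 / M) + 6*‖s₂‖*(U ^ 4 / M) + 4*‖s₃‖*(U ^ 4 / M)
          + ‖D‖*(U ^ 4 / M) := by gcongr
      _ = _ := by ring
  have e5 : ‖K‖ ≤ ‖K‖ * (U ^ 4 / M) :=
    le_mul_of_one_le_right (norm_nonneg _) ((one_le_pow₀ hU1).trans h3M)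
  have e4' := mul_le_mul_of_nonneg_left e4 (norm_nonneg A)
  have hpos : 0 < U ^ 4 / M := by positivity
  refine le_of_mul_le_mul_right ?_ hpos
  calc ‖A‖ * M * (U ^ 4 / M) = ‖A‖ * U ^ 4 := by field_simp
    _ ≤ _ := by linarith

/-- A-priori bound: solutions of (E) that are holomorphic on a closed unit disc are bounded at its
centre by a constant depending only on the coefficients. -/
lemma exists_norm_center_le_of_satisfiesE (b c K s₁ s₂ s₃ : ℂ) (hc : c ≠ 0) :
    ∃ B : ℝ, ∀ (u : ℂ → ℂ) (z₀ : ℂ),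
      (∀ z ∈ Metric.closedBall z₀ 1, AnalyticAt ℂ u z ∧ SatisfiesE b c K s₁ s₂ s₃ u z) →
      ‖u z₀‖ ≤ B := by
  have hA : 0 < ‖30 / c ^ 2‖ := norm_pos_iff.mpr (div_ne_zero (by norm_num) (pow_ne_zero 2 hc))
  refine ⟨max 1 ((2048 + 1920 * ‖b‖ + ‖K‖ + ‖30 / c ^ 2‖ *
      (4 * ‖s₁‖ + 6 * ‖s₂‖ + 4 * ‖s₃‖ + ‖3 * s₁ ^ 4 - 6 * s₁ ^ 2 * s₂ + 4 * s₁ * s₃‖))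
      / ‖30 / c ^ 2‖), fun u z₀ hu => ?_⟩
  have hcont : ContinuousOn (fun z => (1 - dist z z₀) ^ 2 * ‖u z‖) (Metric.closedBall z₀ 1) := by
    have : ContinuousOn u (Metric.closedBall z₀ 1) :=
      fun z hz => (hu z hz).1.continuousAt.continuousWithinAt
    fun_prop
  obtain ⟨z₁, hz₁, hmax⟩ := (isCompact_closedBall z₀ (1 : ℝ)).exists_isMaxOn
    ⟨z₀, Metric.mem_closedBall_self zero_le_one⟩ hcont
  have hmax' : ∀ z ∈ Metric.closedBall z₀ 1,
      (1 - dist z z₀) ^ 2 * ‖u z‖ ≤ (1 - dist z₁ z₀) ^ 2 * ‖u z₁‖ := fun z hz => hmax hz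
  set d := 1 - dist z₁ z₀ with hd
  set M := d ^ 2 * ‖u z₁‖ with hMdef
  have hle : ‖u z₀‖ ≤ M := by
    simpa using hmax' z₀ (Metric.mem_closedBall_self zero_le_one)
  refine hle.trans ?_
  rcases le_or_gt M 1 with hM | hM
  · exact hM.trans (le_max_left _ _)
  refine le_trans ?_ (le_max_right _ _)
  have hd0 : 0 ≤ d := sub_nonneg.mpr hz₁
  have hd1 : d ≤ 1 := by linarith [dist_nonneg (x := z₁) (y := z₀)]
  have hdpos : 0 < d := by
    refine hd0.lt_of_ne fun h => ?_
    rw [hMdef, ← h] at hM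
    norm_num at hM
  have hball : ∀ z ∈ Metric.closedBall z₁ (d / 2), z ∈ Metric.closedBall z₀ 1 ∧ ‖u z‖ ≤ 4 * ‖u z₁‖ := by
    intro z hz
    rw [Metric.mem_closedBall] at hz
    have hdist : d / 2 ≤ 1 - dist z z₀ := by linarith [dist_triangle z z₁ z₀]
    have hz0 : z ∈ Metric.closedBall z₀ 1 := by rw [Metric.mem_closedBall]; linarith
    refine ⟨hz0, ?_⟩
    have h1 : (d / 2) ^ 2 * ‖u z‖ ≤ d ^ 2 * ‖u z₁‖ := (by gcongr : _ ≤ _).trans (hmax' z hz0)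
    have hd2 : 0 < d ^ 2 := by positivity
    nlinarith
  have hdiff : DiffContOnCl ℂ u (Metric.ball z₁ (d / 2)) := by
    refine DifferentiableOn.diffContOnCl_ball (U := Metric.closedBall z₁ (d / 2)) (fun z hz =>
      (hu z (hball z hz).1).1.differentiableAt.differentiableWithinAt) subset_rfl
  have hcauchy := fun n => norm_iteratedDeriv_le_of_forall_mem_sphere_norm_le n (half_pos hdpos)
    hdiff fun z hz => (hball z (Metric.sphere_subset_closedBall hz)).2
  rw [le_div_iff₀ hA, mul_comm]
  refine (hu z₁ hz₁).2.norm_mul_le (half_pos hdpos) hM.le ?_ (by rw [hMdef]; ring) ?_ ?_ ?_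
  · exact mul_le_of_le_one_left (norm_nonneg _) (pow_le_one₀ hd0 hd1)
  · simpa [iteratedDeriv_one] using hcauchy 1
  · refine (hcauchy 2).trans_eq ?_
    norm_num [Nat.factorial]; ring
  · refine (hcauchy 3).trans_eq ?_
    norm_num [Nat.factorial]; ring

/-- A meromorphic function with finitely many poles becomes entire after multiplication by a
suitable nonzero polynomial. -/
lemma MeromorphicOnPlane.exists_polynomial_mul_differentiable {u : ℂ → ℂ}
    (hu : MeromorphicOnPlane u) (hfin : {z : ℂ | IsPoleAt u z}.Finite) :
    ∃ q : Polynomial ℂ, q ≠ 0 ∧ Differentiable ℂ fun z => q.eval z * u z := by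
  have hmero : ∀ s, MeromorphicAt u s := by
    intro s
    refine (hu s).elim (·.meromorphicAt) fun hs => hs.meromorphicAt ?_
    have := hfin.sdiff (t := {s}) |>.isClosed.isOpen_compl.mem_nhds (x := s) (by simp)
    filter_upwards [nhdsWithin_le_nhds this, self_mem_nhdsWithin] with z hz hzs
    exact (hu z).resolve_right fun hp => hz ⟨hp, hzs⟩
  choose n hn using hmero
  have hq : ∀ z, (∏ s ∈ hfin.toFinset, (Polynomial.X - Polynomial.C s) ^ n s).eval z
      = ∏ s ∈ hfin.toFinset, (z - s) ^ n s := fun z => by simp [Polynomial.eval_prod]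
  refine ⟨∏ s ∈ hfin.toFinset, (Polynomial.X - Polynomial.C s) ^ n s,
    Finset.prod_ne_zero_iff.mpr fun s _ => pow_ne_zero _ (Polynomial.X_sub_C_ne_zero s),
    fun z => AnalyticAt.differentiableAt ?_⟩
  simp_rw [hq]
  by_cases hz : IsPoleAt u z
  · have hmem : z ∈ hfin.toFinset := by simpa using hz
    simp_rw [← Finset.mul_prod_erase hfin.toFinset _ hmem, mul_right_comm]
    refine (hn z).mul ?_
    fun_prop
  · have := (hu z).resolve_right hz
    fun_prop

/-- A transcendental (non-rational) meromorphic solution of (E) has infinitely many poles. -/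
theorem transcendental_solution_has_infinitely_many_poles
    (b c K s₁ s₂ s₃ : ℂ) (hc : c ≠ 0)
    (u : ℂ → ℂ) (hu : IsMeromorphicSolution b c K s₁ s₂ s₃ u)
    (htrans : ¬ IsRationalFunction u) :
    {z : ℂ | IsPoleAt u z}.Infinite := by
  intro hfin
  obtain ⟨B, hB⟩ := exists_norm_center_le_of_satisfiesE b c K s₁ s₂ s₃ hc
  obtain ⟨q, hq0, hq⟩ := hu.1.exists_polynomial_mul_differentiable hfin
  obtain ⟨R, hR⟩ := hfin.isBounded.exists_norm_le
  have hbdd : u =O[Bornology.cobounded ℂ] fun _ => (1 : ℂ) := by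
    refine Asymptotics.IsBigO.of_bound B ?_
    filter_upwards [(tendsto_norm_cobounded_atTop (E := ℂ)).eventually_gt_atTop (R + 1)]
      with z₀ hz₀
    rw [norm_one, mul_one]
    refine hB u z₀ fun z hz => ?_
    have ha : AnalyticAt ℂ u z := by
      refine (hu.1 z).resolve_right fun hp => ?_
      have h1 := hR z hp
      have h2 : ‖z₀ - z‖ ≤ 1 := by rwa [← dist_eq_norm, dist_comm]
      linarith [norm_sub_norm_le z₀ z]
    exact ⟨ha, hu.2 z ha⟩
  have hO : (fun z => q.eval z * u z) =O[Bornology.cobounded ℂ] fun z => z ^ q.natDegree := by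
    simpa using q.isBigO_eval_cobounded_pow_natDegree.mul hbdd
  obtain ⟨p, hp⟩ := hq.exists_polynomial_of_isBigO hO
  exact htrans ⟨p, q, hq0, fun z _ hz => by rw [← hp z, mul_div_cancel_left₀ _ hz]⟩

end
end
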